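/- Hölder estimate for the path to a one-point network: Let (Z, d_Z) be a separable metric space, p ∈ [1,∞), z ∈ Z, and let X = (X, ω_X, μ_X) be a (Z,p)-network. For t ∈ [0,1], define the (Z,p)-network X_t = (X ⊔ {⋆}, ω̂, (1−t)μ_X + tδ_⋆), where ω̂(u,v) = ω_X(u,v) if u, v ∈ X and ω̂(u,v) = z otherwise, and δ_⋆ is the Dirac measure at ⋆. Then for all s, t ∈ [0,1], GW_p^Z(X_s, X_t) ≤ ((3|t−s|)^{1/p}/2) · size_{p,z}(X). -/

import Mathlib

open MeasureTheory

noncomputable section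

/-- The set of couplings of two measures: probability measures on the product
whose marginals are `μ` and `ν`. -/
def Couplings {X Y : Type*} [MeasurableSpace X] [MeasurableSpace Y]
    (μ : Measure X) (ν : Measure Y) : Set (Measure (X × Y)) :=
  {π | IsProbabilityMeasure π ∧ π.map Prod.fst = μ ∧ π.map Prod.snd = ν}

/-- The `p`-distortion of a coupling `π`, for kernels `ωX`, `ωY` valued in a
(pseudo)metric space `Z`. -/
def dis {X Y Z : Type*} [MeasurableSpace X] [MeasurableSpace Y] [PseudoMetricSpace Z]
    (p : ℝ) (ωX : X × X → Z) (ωY : Y × Y → Z) (π : Measure (X × Y)) : ℝ :=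
  (∫ w : X × Y, ∫ w' : X × Y,
      dist (ωX (w.1, w'.1)) (ωY (w.2, w'.2)) ^ p ∂π ∂π) ^ (1 / p)

/-- The `Z`-Gromov–Wasserstein `p`-distance between `(X, ωX, μX)` and `(Y, ωY, μY)`. -/
def GW {X Y Z : Type*} [MeasurableSpace X] [MeasurableSpace Y] [PseudoMetricSpace Z]
    (p : ℝ) (ωX : X × X → Z) (μX : Measure X) (ωY : Y × Y → Z) (μY : Measure Y) : ℝ :=
  (1 / 2) * sInf (dis p ωX ωY '' Couplings μX μY)

/-- `(X, ω, μ)` is a `(Z,p)`-network: `μ` is a Borel probability measure, `ω` is Borel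
measurable, and `∬ d_Z(ω(x,x'), z₀)^p dμ dμ < ∞` for some `z₀`. -/
structure IsNetwork {X Z : Type*} [MeasurableSpace X] [MeasurableSpace Z] [PseudoMetricSpace Z]
    (p : ℝ) (ω : X × X → Z) (μ : Measure X) : Prop where
  prob : IsProbabilityMeasure μ
  meas : Measurable ω
  integ : ∃ z₀ : Z, (∫⁻ x, ∫⁻ x', ENNReal.ofReal (dist (ω (x, x')) z₀ ^ p) ∂μ ∂μ) < ⊤

/-- The kernel `ω̂` on `X ⊔ {⋆}` extending `ω` by the constant value `z`. -/
def hatKernel {X Z : Type*} (ω : X × X → Z) (z : Z) :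
    (X ⊕ Unit) × (X ⊕ Unit) → Z
  | (Sum.inl x, Sum.inl x') => ω (x, x')
  | _ => z

/-- The measure `(1−t)·μ + t·δ_⋆` on `X ⊔ {⋆}`. -/
def mixDirac {X : Type*} [MeasurableSpace X] (μ : Measure X) (t : ℝ) :
    Measure (X ⊕ Unit) :=
  ENNReal.ofReal (1 - t) • μ.map Sum.inl + ENNReal.ofReal t • Measure.dirac (Sum.inr ())

/-- The `p`-size of a network relative to a base point `z`. -/
def sizeP {X Z : Type*} [MeasurableSpace X] [PseudoMetricSpace Z]
    (p : ℝ) (ω : X × X → Z) (μ : Measure X) (z : Z) : ℝ :=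
  (∫ x, ∫ x', dist (ω (x, x')) z ^ p ∂μ ∂μ) ^ (1 / p)

open scoped ENNReal

theorem measurable_hatKernel {X Z : Type*} [MeasurableSpace X] [MeasurableSpace Z]
    {ω : X × X → Z} (hω : Measurable ω) (z : Z) : Measurable (hatKernel ω z) := by
  have hinl : MeasurableEmbedding (Sum.inl : X → X ⊕ Unit) :=
    ⟨Sum.inl_injective, measurable_inl, fun _ h ↦ h.inl_image⟩
  have he : MeasurableEmbedding
      (Prod.map Sum.inl Sum.inl : X × X → (X ⊕ Unit) × (X ⊕ Unit)) :=
    hinl.prodMap hinl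
  have h : hatKernel ω z = Function.extend
      (Prod.map Sum.inl Sum.inl : X × X → (X ⊕ Unit) × (X ⊕ Unit)) ω (fun _ ↦ z) := by
    funext w
    rcases w with ⟨x | u, x' | u'⟩
    · exact (he.injective.extend_apply ω (fun _ ↦ z) (x, x')).symm
    all_goals
      rw [Function.extend_apply']
      · rfl
      · rintro ⟨⟨a, b⟩, h⟩
        simp at h
  rw [h]
  exact he.measurable_extend hω measurable_const

theorem integral_integral_dist_rpow {α Z : Type*} [MeasurableSpace α] [MetricSpace Z]
    [MeasurableSpace Z] [BorelSpace Z] [SecondCountableTopology Z] {p : ℝ} (hp : 0 ≤ p)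
    {f g : α × α → Z} (hf : Measurable f) (hg : Measurable g) (μ : Measure α) [SFinite μ]
    (hfin : ∫⁻ a, ∫⁻ b, edist (f (a, b)) (g (a, b)) ^ p ∂μ ∂μ ≠ ∞) :
    ∫ a, ∫ b, dist (f (a, b)) (g (a, b)) ^ p ∂μ ∂μ =
      (∫⁻ a, ∫⁻ b, edist (f (a, b)) (g (a, b)) ^ p ∂μ ∂μ).toReal := by
  have hm : Measurable fun w : α × α ↦ edist (f w) (g w) ^ p := (hf.edist hg).pow_const p
  have hm' : Measurable fun w : α × α ↦ dist (f w) (g w) ^ p := (hf.dist hg).pow_const p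
  have hin : Measurable fun a ↦ ∫⁻ b, edist (f (a, b)) (g (a, b)) ^ p ∂μ :=
    hm.lintegral_prod_right'
  rw [← integral_toReal hin.aemeasurable (ae_lt_top hin hfin)]
  congr 1 with a
  have ha : Measurable fun b ↦ dist (f (a, b)) (g (a, b)) ^ p :=
    hm'.comp measurable_prodMk_left
  rw [integral_eq_lintegral_of_nonneg_ae (.of_forall fun b ↦ by positivity)
    ha.aestronglyMeasurable]
  simp_rw [← ENNReal.ofReal_rpow_of_nonneg dist_nonneg hp, edist_dist]

theorem dis_nonneg {X Y Z : Type*} [MeasurableSpace X] [MeasurableSpace Y]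
    [PseudoMetricSpace Z] (p : ℝ) (ωX : X × X → Z) (ωY : Y × Y → Z) (π : Measure (X × Y)) :
    0 ≤ dis p ωX ωY π :=
  Real.rpow_nonneg (integral_nonneg fun _ ↦ integral_nonneg fun _ ↦ by positivity) _

theorem map_swap_mem_couplings {X Y : Type*} [MeasurableSpace X] [MeasurableSpace Y]
    {μ : Measure X} {ν : Measure Y} {π : Measure (X × Y)} (hπ : π ∈ Couplings μ ν) :
    π.map Prod.swap ∈ Couplings ν μ := by
  obtain ⟨h, h₁, h₂⟩ := hπ
  refine ⟨Measure.isProbabilityMeasure_map measurable_swap.aemeasurable, ?_, ?_⟩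
  · rw [Measure.map_map measurable_fst measurable_swap]
    exact h₂
  · rw [Measure.map_map measurable_snd measurable_swap]
    exact h₁

theorem dis_map_swap {X Y Z : Type*} [MeasurableSpace X] [MeasurableSpace Y]
    [PseudoMetricSpace Z] (p : ℝ) (ωX : X × X → Z) (ωY : Y × Y → Z) (π : Measure (X × Y)) :
    dis p ωY ωX (π.map Prod.swap) = dis p ωX ωY π := by
  have h (f : Y × X → ℝ) : ∫ w, f w ∂(π.map Prod.swap) = ∫ w, f w.swap ∂π :=
    integral_map_equiv MeasurableEquiv.prodComm f
  simp_rw [dis, h, Prod.fst_swap, Prod.snd_swap, dist_comm]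

theorem GW_comm {X Y Z : Type*} [MeasurableSpace X] [MeasurableSpace Y] [PseudoMetricSpace Z]
    (p : ℝ) (ωX : X × X → Z) (μX : Measure X) (ωY : Y × Y → Z) (μY : Measure Y) :
    GW p ωX μX ωY μY = GW p ωY μY ωX μX := by
  unfold GW
  congr 2
  refine Set.Subset.antisymm ?_ ?_ <;>
  · rintro _ ⟨π, hπ, rfl⟩
    exact ⟨_, map_swap_mem_couplings hπ, dis_map_swap ..⟩

theorem GW_le_of_mem_couplings {X Y Z : Type*} [MeasurableSpace X] [MeasurableSpace Y]
    [PseudoMetricSpace Z] (p : ℝ) (ωX : X × X → Z) {μX : Measure X} (ωY : Y × Y → Z)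
    {μY : Measure Y} {π : Measure (X × Y)} (hπ : π ∈ Couplings μX μY) :
    GW p ωX μX ωY μY ≤ 1 / 2 * dis p ωX ωY π := by
  unfold GW
  gcongr
  refine csInf_le ⟨0, ?_⟩ ⟨π, hπ, rfl⟩
  rintro _ ⟨π', -, rfl⟩
  exact dis_nonneg ..

theorem IsNetwork.lintegral_edist_rpow_ne_top {X Z : Type*} [MeasurableSpace X]
    [MetricSpace Z] [MeasurableSpace Z] [BorelSpace Z] [SecondCountableTopology Z]
    {p : ℝ} (hp : 1 ≤ p) {ω : X × X → Z} {μ : Measure X} (h : IsNetwork p ω μ) (z : Z) :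
    ∫⁻ x, ∫⁻ x', edist (ω (x, x')) z ^ p ∂μ ∂μ ≠ ∞ := by
  have hp0 : 0 ≤ p := by linarith
  have := h.prob
  obtain ⟨z₀, hz₀⟩ := h.integ
  simp_rw [← ENNReal.ofReal_rpow_of_nonneg dist_nonneg hp0, ← edist_dist] at hz₀
  have hm : Measurable fun w : X × X ↦ edist (ω w) z₀ ^ p :=
    (h.meas.edist measurable_const).pow_const p
  refine ne_top_of_le_ne_top (b := 2 ^ (p - 1) *
    (∫⁻ x, ∫⁻ x', edist (ω (x, x')) z₀ ^ p ∂μ ∂μ + edist z₀ z ^ p)) ?_ ?_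
  · have h2 : (2 : ℝ≥0∞) ^ (p - 1) ≠ ∞ := ENNReal.rpow_ne_top_of_nonneg (by linarith) (by simp)
    have h3 : edist z₀ z ^ p ≠ ∞ := ENNReal.rpow_ne_top_of_nonneg hp0 (edist_ne_top _ _)
    exact ENNReal.mul_ne_top h2 (ENNReal.add_ne_top.2 ⟨hz₀.ne, h3⟩)
  · calc ∫⁻ x, ∫⁻ x', edist (ω (x, x')) z ^ p ∂μ ∂μ
        ≤ ∫⁻ x, ∫⁻ x', 2 ^ (p - 1) * (edist (ω (x, x')) z₀ ^ p + edist z₀ z ^ p) ∂μ ∂μ := by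
          gcongr with x x'
          exact (ENNReal.rpow_le_rpow (edist_triangle _ z₀ _) hp0).trans
            (ENNReal.rpow_add_le_mul_rpow_add_rpow _ _ hp)
      _ = _ := by
          have hx (x : X) : Measurable fun x' ↦ edist (ω (x, x')) z₀ ^ p :=
            hm.comp measurable_prodMk_left
          have hin : Measurable fun x ↦ ∫⁻ x', edist (ω (x, x')) z₀ ^ p ∂μ :=
            hm.lintegral_prod_right'
          have hin' (x : X) :
              ∫⁻ x', 2 ^ (p - 1) * (edist (ω (x, x')) z₀ ^ p + edist z₀ z ^ p) ∂μ =
                2 ^ (p - 1) * (∫⁻ x', edist (ω (x, x')) z₀ ^ p ∂μ + edist z₀ z ^ p) := by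
            rw [lintegral_const_mul _ ((hx x).add_const _), lintegral_add_left (hx x)]
            simp
          simp_rw [hin']
          rw [lintegral_const_mul _ (hin.add_const _), lintegral_add_left hin]
          simp

/-- The coupling of `mixDirac μ s` and `mixDirac μ t`, for `s ≤ t`, that keeps the mass
`1 - t` in place, moves the mass `t - s` to the added point, and leaves the mass `s` there. -/
def mixDiracCoupling {X : Type*} [MeasurableSpace X] (μ : Measure X) (s t : ℝ) :
    Measure ((X ⊕ Unit) × (X ⊕ Unit)) :=
  ENNReal.ofReal (1 - t) • μ.map (fun x ↦ (Sum.inl x, Sum.inl x)) +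
    ENNReal.ofReal (t - s) • μ.map (fun x ↦ (Sum.inl x, Sum.inr ())) +
    ENNReal.ofReal s • Measure.dirac (Sum.inr (), Sum.inr ())

theorem lintegral_mixDiracCoupling {X : Type*} [MeasurableSpace X] (μ : Measure X) (s t : ℝ)
    {F : (X ⊕ Unit) × (X ⊕ Unit) → ℝ≥0∞} (hF : Measurable F) :
    ∫⁻ w, F w ∂(mixDiracCoupling μ s t) =
      ENNReal.ofReal (1 - t) * ∫⁻ x, F (Sum.inl x, Sum.inl x) ∂μ +
        ENNReal.ofReal (t - s) * ∫⁻ x, F (Sum.inl x, Sum.inr ()) ∂μ +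
        ENNReal.ofReal s * F (Sum.inr (), Sum.inr ()) := by
  simp_rw [mixDiracCoupling, lintegral_add_measure, lintegral_smul_measure, smul_eq_mul]
  rw [lintegral_map hF (by fun_prop), lintegral_map hF (by fun_prop), lintegral_dirac' _ hF]

theorem mixDiracCoupling_mem_couplings {X : Type*} [MeasurableSpace X] (μ : Measure X)
    [IsProbabilityMeasure μ] {s t : ℝ} (hs : 0 ≤ s) (hst : s ≤ t) (ht : t ≤ 1) :
    mixDiracCoupling μ s t ∈ Couplings (mixDirac μ s) (mixDirac μ t) := by
  refine ⟨⟨?_⟩, ?_, ?_⟩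
  · rw [← lintegral_one, lintegral_mixDiracCoupling _ _ _ measurable_const]
    simp only [lintegral_one, measure_univ, mul_one]
    rw [← ENNReal.ofReal_add (by linarith) (by linarith),
      ← ENNReal.ofReal_add (by linarith) (by linarith)]
    simp
  · rw [mixDiracCoupling, Measure.map_add _ _ measurable_fst, Measure.map_add _ _ measurable_fst,
      Measure.map_smul, Measure.map_smul, Measure.map_smul,
      Measure.map_map measurable_fst (by fun_prop), Measure.map_map measurable_fst (by fun_prop),
      Measure.map_dirac' measurable_fst, mixDirac]
    simp only [Function.comp_def]
    rw [← add_smul, ← ENNReal.ofReal_add (by linarith) (by linarith)]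
    congr 3
    ring
  · rw [mixDiracCoupling, Measure.map_add _ _ measurable_snd, Measure.map_add _ _ measurable_snd,
      Measure.map_smul, Measure.map_smul, Measure.map_smul,
      Measure.map_map measurable_snd (by fun_prop), Measure.map_map measurable_snd (by fun_prop),
      Measure.map_dirac' measurable_snd, mixDirac]
    simp only [Function.comp_def, Measure.map_const, measure_univ, one_smul]
    rw [add_assoc, ← add_smul, ← ENNReal.ofReal_add (by linarith) (by linarith)]
    congr 3
    ring

theorem lintegral_edist_rpow_mixDiracCoupling {X Z : Type*} [MeasurableSpace X]
    [MetricSpace Z] [MeasurableSpace Z] [BorelSpace Z] [SecondCountableTopology Z]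
    {p : ℝ} (hp : 0 < p) {ω : X × X → Z} (hω : Measurable ω) (z : Z) (μ : Measure X)
    [IsProbabilityMeasure μ] {s t : ℝ} (hst : s ≤ t) (ht : t ≤ 1) :
    ∫⁻ w, ∫⁻ w', edist (hatKernel ω z (w.1, w'.1)) (hatKernel ω z (w.2, w'.2)) ^ p
        ∂(mixDiracCoupling μ s t) ∂(mixDiracCoupling μ s t) =
      ENNReal.ofReal ((t - s) * (2 - s - t)) *
        ∫⁻ x, ∫⁻ x', edist (ω (x, x')) z ^ p ∂μ ∂μ := by
  have hk := measurable_hatKernel hω z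
  have hm : Measurable fun q : ((X ⊕ Unit) × (X ⊕ Unit)) × ((X ⊕ Unit) × (X ⊕ Unit)) ↦
      edist (hatKernel ω z (q.1.1, q.2.1)) (hatKernel ω z (q.1.2, q.2.2)) ^ p := by
    fun_prop
  have : SFinite (mixDiracCoupling μ s t) := by unfold mixDiracCoupling; infer_instance
  have hin : Measurable fun x ↦ ∫⁻ x', edist (ω (x, x')) z ^ p ∂μ :=
    ((hω.edist measurable_const).pow_const p).lintegral_prod_right'
  have hw (u v : X ⊕ Unit) :=
    lintegral_mixDiracCoupling μ s t (hm.comp (measurable_prodMk_left (x := (u, v))))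
  simp only [Function.comp_apply] at hw
  refine (lintegral_mixDiracCoupling μ s t hm.lintegral_prod_right').trans ?_
  simp only [hw]
  simp only [hatKernel, edist_self, ENNReal.zero_rpow_of_pos hp,
    lintegral_zero, mul_zero, zero_add, add_zero]
  rw [lintegral_const_mul _ hin, lintegral_add_left (hin.const_mul _),
    lintegral_const_mul _ hin, lintegral_const_mul _ hin,
    show (t - s) * (2 - s - t) = (t - s) * ((1 - t) + (1 - t) + (t - s)) by ring,
    ENNReal.ofReal_mul (by linarith), ENNReal.ofReal_add (by linarith) (by linarith),
    ENNReal.ofReal_add (by linarith) (by linarith)]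
  ring

theorem GW_mixDirac_le {X Z : Type*} [MeasurableSpace X]
    [MetricSpace Z] [MeasurableSpace Z] [BorelSpace Z] [SecondCountableTopology Z]
    {p : ℝ} (hp : 1 ≤ p) (z : Z) {ω : X × X → Z} {μ : Measure X} (h : IsNetwork p ω μ)
    {s t : ℝ} (hs : 0 ≤ s) (hst : s ≤ t) (ht : t ≤ 1) :
    GW p (hatKernel ω z) (mixDirac μ s) (hatKernel ω z) (mixDirac μ t) ≤
      ((t - s) * (2 - s - t)) ^ (1 / p) / 2 * sizeP p ω μ z := by
  have hp0 : 0 < p := by linarith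
  have := h.prob
  have hk := measurable_hatKernel h.meas z
  have hc := mixDiracCoupling_mem_couplings μ hs hst ht
  have := hc.1
  have hfin := h.lintegral_edist_rpow_ne_top hp z
  have hE := lintegral_edist_rpow_mixDiracCoupling hp0 h.meas z μ hst ht
  have hnn : 0 ≤ (t - s) * (2 - s - t) := mul_nonneg (by linarith) (by linarith)
  refine (GW_le_of_mem_couplings p _ _ hc).trans_eq ?_
  have hD := integral_integral_dist_rpow hp0.le
    (f := fun q ↦ hatKernel ω z (q.1.1, q.2.1)) (g := fun q ↦ hatKernel ω z (q.1.2, q.2.2))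
    (by fun_prop) (by fun_prop) (mixDiracCoupling μ s t)
    (by rw [hE]; exact ENNReal.mul_ne_top (by simp) hfin)
  have hS := integral_integral_dist_rpow hp0.le h.meas (g := fun _ ↦ z) measurable_const μ hfin
  rw [dis, sizeP, hD, hE, hS, ENNReal.toReal_mul, ENNReal.toReal_ofReal hnn,
    Real.mul_rpow hnn ENNReal.toReal_nonneg]
  ring

/-- **Hölder estimate for the path to a one-point network**: with
`X_t = (X ⊔ {⋆}, ω̂, (1−t)μX + tδ_⋆)`, one has
`GW_p^Z(X_s, X_t) ≤ ((3|t−s|)^{1/p}/2) · size_{p,z}(X)` for all `s, t ∈ [0,1]`. -/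
theorem gw_one_point_path_Holder
    {X Z : Type*}
    [MeasurableSpace X] [TopologicalSpace X] [PolishSpace X] [BorelSpace X]
    [MetricSpace Z] [MeasurableSpace Z] [BorelSpace Z] [TopologicalSpace.SeparableSpace Z]
    (p : ℝ) (hp : 1 ≤ p) (z : Z)
    (ωX : X × X → Z) (μX : Measure X) (hX : IsNetwork p ωX μX) :
    ∀ s ∈ Set.Icc (0 : ℝ) 1, ∀ t ∈ Set.Icc (0 : ℝ) 1,
      GW p (hatKernel ωX z) (mixDirac μX s) (hatKernel ωX z) (mixDirac μX t) ≤
        (3 * |t - s|) ^ (1 / p) / 2 * sizeP p ωX μX z := by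
  have : SecondCountableTopology Z := UniformSpace.secondCountable_of_separable Z
  have key {s t : ℝ} (hs : 0 ≤ s) (hst : s ≤ t) (ht : t ≤ 1) :
      GW p (hatKernel ωX z) (mixDirac μX s) (hatKernel ωX z) (mixDirac μX t) ≤
        (3 * |t - s|) ^ (1 / p) / 2 * sizeP p ωX μX z := by
    refine (GW_mixDirac_le hp z hX hs hst ht).trans ?_
    have hS : 0 ≤ sizeP p ωX μX z :=
      Real.rpow_nonneg (integral_nonneg fun _ ↦ integral_nonneg fun _ ↦ by positivity) _
    have hle : (t - s) * (2 - s - t) ≤ 3 * |t - s| := by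
      rw [abs_of_nonneg (by linarith), mul_comm]
      exact mul_le_mul_of_nonneg_right (by linarith) (by linarith)
    have h0 : 0 ≤ (t - s) * (2 - s - t) := mul_nonneg (by linarith) (by linarith)
    have hr := Real.rpow_le_rpow h0 hle (by positivity : 0 ≤ 1 / p)
    gcongr
  intro s hs t ht
  rcases le_total s t with h | h
  · exact key hs.1 h ht.2
  · rw [GW_comm, abs_sub_comm]
    exact key ht.1 h hs.2
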